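/- Fix h1 > h2 > 0, λ* ∈ (0,1), and constants 0 < c1 < 1 < c2 < ∞. There exists a constant c > 0 such that for all λ ∈ [λ*,1) and all integers M with c1/(1−λ) ≤ M ≤ c2/(1−λ) and M ≥ 2, Σ_{(y1,y2) ∈ ℕ²} min( P(S_M(λ,h1) = y1)·P(S_M(λ,h1) = y2), P(S_M(λ,h2) = y1)·P(S_M(λ,h2) = y2) ) ≥ c. -/

import Mathlib

open Set Filter MeasureTheory

/-- Extinction-type parameter of the TKF91 model (deletion rate 1, insertion rate `lam`). -/
noncomputable def eta (lam t : ℝ) : ℝ :=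
  (1 - Real.exp (-(1 - lam) * t)) / (1 - lam * Real.exp (-(1 - lam) * t))

/-- TKF91 mortal-link progeny-length pmf `p_{λ,t}`. -/
noncomputable def pTKF (lam t : ℝ) : ℕ → ℝ
  | 0 => eta lam t
  | (n + 1) => (1 - eta lam t) * (1 - lam * eta lam t) * (lam * eta lam t) ^ n

/-- TKF91 immortal-link progeny pmf `q_{λ,t}`. -/
noncomputable def qTKF (lam t : ℝ) (n : ℕ) : ℝ :=
  (1 - lam * eta lam t) * (lam * eta lam t) ^ n

/-- pmf of `S_M(λ,t)`, a sum of `M` i.i.d. variables with law `p_{λ,t}`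
(`M`-fold convolution of `pTKF lam t`). -/
noncomputable def pS (lam t : ℝ) : ℕ → ℕ → ℝ
  | 0 => fun n => if n = 0 then 1 else 0
  | (M + 1) => fun n => ∑ k ∈ Finset.range (n + 1), pS lam t M k * pTKF lam t (n - k)

/-- pmf of the leaf sequence length `N = G + S_M(λ,t)` with `G ~ q_{λ,t}` independent. -/
noncomputable def pLeaf (lam t : ℝ) (M n : ℕ) : ℝ :=
  ∑ k ∈ Finset.range (n + 1), qTKF lam t k * pS lam t M (n - k)

/-- Joint distribution on `ℕ × ℕ` of the pair of leaf lengths of the two-leaf star tree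
of height `h`, with stationary geometric root length. -/
noncomputable def Ldist (lam h : ℝ) (y : ℕ × ℕ) : ℝ :=
  ∑' M : ℕ, (1 - lam) * lam ^ M * (pLeaf lam h M y.1 * pLeaf lam h M y.2)

/-- Mean of `p_{λ,t}`. -/
noncomputable def betaTKF (lam t : ℝ) : ℝ := Real.exp (-(1 - lam) * t)

/-- Standard deviation of `p_{λ,t}`. -/
noncomputable def sdev (lam t : ℝ) : ℝ :=
  Real.sqrt (∑' n : ℕ, ((n : ℝ) - betaTKF lam t) ^ 2 * pTKF lam t n)

/-- `P(S_M(λ,t) ∈ (a,b))`. -/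
noncomputable def probIn (lam t : ℝ) (M : ℕ) (a b : ℝ) : ℝ :=
  ∑' j : ℕ, if (j : ℝ) ∈ Set.Ioo a b then pS lam t M j else 0

/-- CDF of `S_M(λ,t)`. -/
noncomputable def cdfS (lam t : ℝ) (M : ℕ) (x : ℝ) : ℝ :=
  ∑' j : ℕ, if (j : ℝ) ≤ x then pS lam t M j else 0

/-- Standard normal CDF. -/
noncomputable def stdNormalCDF (x : ℝ) : ℝ :=
  ∫ u in Set.Iic x, Real.exp (-u ^ 2 / 2) / Real.sqrt (2 * Real.pi)


lemma central_lower (m : ℕ) (hm : 1 ≤ m) :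
    (4 : ℝ) ^ m * (4 : ℝ) ^ m ≤ 4 * m * ((Nat.centralBinom m : ℝ) * Nat.centralBinom m) := by
  induction m, hm using Nat.le_induction with
  | base => norm_num [Nat.centralBinom, Nat.choose]
  | succ n hn ih =>
    have h : ((n : ℝ) + 1) * (Nat.centralBinom (n + 1)) = 2 * (2 * n + 1) * Nat.centralBinom n := by
      exact_mod_cast Nat.succ_mul_centralBinom_succ n
    have hn' : (1 : ℝ) ≤ n := by exact_mod_cast hn
    set u : ℝ := ((Nat.centralBinom n : ℕ) : ℝ)
    set w : ℝ := ((Nat.centralBinom (n + 1) : ℕ) : ℝ)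
    have hw : w = 2 * (2 * n + 1) * u / (n + 1) := by field_simp; linarith
    have key : 16 * (4 * n * (u * u)) ≤ 4 * ((n : ℝ) + 1) * (w * w) := by
      rw [hw]
      have : 4 * ((n : ℝ) + 1) * (2 * (2 * n + 1) * u / (n + 1) * (2 * (2 * n + 1) * u / (n + 1)))
        = 16 * (2 * n + 1) ^ 2 * u ^ 2 / (n + 1) := by field_simp; ring
      rw [this, le_div_iff₀ (by positivity)]
      nlinarith [sq_nonneg u]
    push_cast
    rw [pow_succ]
    linarith

lemma choose_off (m j : ℕ) (hm : 1 ≤ m) (hj : 4 * j ≤ m) (i : ℕ) (hi : i ≤ j) :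
    Real.exp (-(4 * j / m)) ^ i * (Nat.centralBinom m : ℝ) ≤ Nat.choose (2 * m) (m + i) := by
  induction i with
  | zero => simp [Nat.centralBinom]
  | succ i ih =>
    have ih := ih (by omega)
    have h : ((Nat.choose (2 * m) (m + (i + 1)) : ℕ) : ℝ) * (m + i + 1)
        = (Nat.choose (2 * m) (m + i) : ℕ) * ((m : ℝ) - i) := by
      have := Nat.choose_succ_right_eq (2 * m) (m + i)
      have e : 2 * m - (m + i) = m - i := by omega
      rw [e] at this
      have h2 : ((m - i : ℕ) : ℝ) = (m : ℝ) - i := by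
        rw [Nat.cast_sub (by omega)]
      rw [← h2]
      have := congrArg (Nat.cast : ℕ → ℝ) this
      push_cast at this
      rw [← this]
      simp [add_assoc]
    have hm' : (1 : ℝ) ≤ m := by exact_mod_cast hm
    have hij : (i : ℝ) + 1 ≤ j := by exact_mod_cast hi
    have hj' : 4 * (j : ℝ) ≤ m := by exact_mod_cast hj
    have hx : (2 * j / m : ℝ) ≤ 1 / 2 := by rw [div_le_iff₀ (by positivity)]; linarith
    have hx0 : (0 : ℝ) ≤ 2 * j / m := by positivity
    have hexp : Real.exp (-(4 * j / m)) ≤ 1 - 2 * j / m := by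
      set x : ℝ := 2 * j / m with hxdef
      have e1 : (4 * j / m : ℝ) = 2 * x := by rw [hxdef]; ring
      rw [e1, Real.exp_neg, inv_le_comm₀ (Real.exp_pos _) (by linarith)]
      have h3 := Real.add_one_le_exp (2 * x)
      refine le_trans ?_ h3
      rw [inv_le_iff_one_le_mul₀ (by linarith)]
      nlinarith
    have hr : 1 - 2 * j / m ≤ ((m : ℝ) - i) / (m + i + 1) := by
      rw [le_div_iff₀ (by positivity)]
      have : (1 - 2 * j / m : ℝ) * (m + i + 1) = (m + i + 1) - 2 * j - 2 * j / m * (i + 1) := by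
        field_simp; ring
      rw [this]
      have : 0 ≤ 2 * j / m * ((i : ℝ) + 1) := by positivity
      linarith
    have h' : ((Nat.choose (2 * m) (m + (i + 1)) : ℕ) : ℝ)
        = (Nat.choose (2 * m) (m + i) : ℕ) * (((m : ℝ) - i) / (m + i + 1)) := by
      field_simp; linarith
    rw [h', pow_succ, mul_right_comm]
    exact mul_le_mul ih (hexp.trans hr) (Real.exp_pos _).le (by positivity)

lemma choose_even (m j : ℕ) (hm : 1 ≤ m) (hj : 4 * j ≤ m) (R : ℝ) (hR : (j : ℝ) ^ 2 ≤ R * m) (N : ℕ)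
    (hN : N = m + j ∨ N + j = m) :
    Real.exp (-(4 * R)) / (2 * Real.sqrt m) ≤ Nat.choose (2 * m) N / 4 ^ m := by
  have e : Nat.choose (2 * m) N = Nat.choose (2 * m) (m + j) := by
    rcases hN with h | h
    · rw [h]
    · rw [← Nat.choose_symm (by omega : N ≤ 2 * m)]
      congr 1; omega
  rw [e]
  have h1 := choose_off m j hm hj j le_rfl
  have h2 := central_lower m hm
  have hm' : (1 : ℝ) ≤ m := by exact_mod_cast hm
  have hs : 0 < Real.sqrt m := Real.sqrt_pos.2 (by linarith)
  have hss : Real.sqrt m * Real.sqrt m = m := Real.mul_self_sqrt (by linarith)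
  have h3 : (4 : ℝ) ^ m ≤ 2 * Real.sqrt m * Nat.centralBinom m := by
    apply (mul_self_le_mul_self_iff (by positivity) (by positivity)).2
    refine h2.trans (le_of_eq ?_)
    linear_combination (-4 * (Nat.centralBinom m : ℝ) * Nat.centralBinom m) * hss
  have h4 : Real.exp (-(4 * R)) ≤ Real.exp (-(4 * j / m)) ^ j := by
    rw [← Real.exp_nat_mul]
    apply Real.exp_le_exp.2
    have : (j : ℝ) * -(4 * j / m) = - (4 * (j ^ 2 / m)) := by ring
    rw [this]
    have : (j : ℝ) ^ 2 / m ≤ R := by rwa [div_le_iff₀ (by linarith)]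
    linarith
  rw [div_le_div_iff₀ (by positivity) (by positivity)]
  calc Real.exp (-(4 * R)) * 4 ^ m ≤ Real.exp (-(4 * j / m)) ^ j * (2 * Real.sqrt m * Nat.centralBinom m) := by
        apply mul_le_mul h4 h3 (by positivity) (by positivity)
    _ = (Real.exp (-(4 * j / m)) ^ j * Nat.centralBinom m) * (2 * Real.sqrt m) := by ring
    _ ≤ _ := by gcongr

lemma binom_lower (K : ℝ) (hK : 0 < K) : ∃ c : ℝ, 0 < c ∧ ∃ b0 : ℝ, 0 < b0 ∧ ∀ b : ℕ, b0 ≤ b →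
    ∀ N : ℕ, (2 * (N : ℝ) - b) ^ 2 ≤ K * b → c / Real.sqrt b ≤ Nat.choose b N / 2 ^ b := by
  set R : ℝ := 3 * K + 1 with hR
  refine ⟨Real.exp (-(4 * R)) / 4, by positivity, 64 * R + 4, by positivity, ?_⟩
  intro b hb N hN
  obtain ⟨m, r, hr, rfl⟩ : ∃ m r : ℕ, r ≤ 1 ∧ b = 2 * m + r :=
    ⟨b / 2, b % 2, by omega, by omega⟩
  have hr' : (r : ℝ) ≤ 1 := by exact_mod_cast hr
  have hr0 : (0 : ℝ) ≤ r := by positivity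
  push_cast at hb hN
  have hm : 16 * R + 1 ≤ m := by nlinarith
  have hm1 : 1 ≤ m := by
    have : (1 : ℝ) ≤ m := by nlinarith
    exact_mod_cast this
  have hm1' : (1 : ℝ) ≤ m := by exact_mod_cast hm1
  obtain ⟨j, hj⟩ : ∃ j : ℕ, N = m + j ∨ N + j = m := by
    rcases le_total N m with h | h
    · exact ⟨m - N, Or.inr (by omega)⟩
    · exact ⟨N - m, Or.inl (by omega)⟩
  have hjsq : (j : ℝ) ^ 2 = (N - m) ^ 2 := by
    rcases hj with h | h
    · rw [h]; push_cast; ring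
    · rw [← h]; push_cast; ring
  have hj2 : (j : ℝ) ^ 2 ≤ R * m := by
    rw [hjsq, hR]
    nlinarith [sq_nonneg ((2 * (N : ℝ) - (2 * m + r)) - r), mul_nonneg hK.le (by linarith : (0:ℝ) ≤ m - r)]
  have hj4 : 4 * j ≤ m := by
    have : 4 * (j : ℝ) ≤ m := by
      apply le_of_sq_le_sq _ (by positivity)
      nlinarith
    exact_mod_cast this
  have := choose_even m j hm1 hj4 R hj2 N hj
  have hch : (Nat.choose (2 * m) N : ℝ) ≤ Nat.choose (2 * m + r) N := by
    exact_mod_cast Nat.choose_le_choose N (by omega)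
  have hs : Real.sqrt m ≤ Real.sqrt ((2 * m + r : ℕ) : ℝ) := by
    apply Real.sqrt_le_sqrt; push_cast; linarith
  have hs0 : 0 < Real.sqrt m := Real.sqrt_pos.2 (by linarith)
  have h2 : (2 : ℝ) ^ (2 * m + r) ≤ 2 * 4 ^ m := by
    have : (2 : ℝ) ^ r ≤ 2 := by interval_cases r <;> norm_num
    rw [pow_add, pow_mul]; norm_num
    nlinarith [pow_pos (by norm_num : (0:ℝ) < 4) m]
  calc Real.exp (-(4 * R)) / 4 / Real.sqrt ((2 * m + r : ℕ) : ℝ)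
      ≤ Real.exp (-(4 * R)) / 4 / Real.sqrt m := by gcongr
    _ = (Real.exp (-(4 * R)) / (2 * Real.sqrt m)) / 2 := by field_simp; norm_num
    _ ≤ (Nat.choose (2 * m) N / 4 ^ m) / 2 := by gcongr
    _ = Nat.choose (2 * m) N / (2 * 4 ^ m) := by field_simp
    _ ≤ Nat.choose (2 * m + r) N / 2 ^ (2 * m + r) := by gcongr

open PowerSeries in
lemma pS_eq_coeff (lam t : ℝ) (M n : ℕ) :
    pS lam t M n = coeff n ((PowerSeries.mk (pTKF lam t)) ^ M) := by
  induction M generalizing n with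
  | zero => simp [pS, coeff_one]
  | succ M ih =>
    rw [pow_succ, coeff_mul, Finset.Nat.sum_antidiagonal_eq_sum_range_succ_mk]
    simp [pS, ih]

/-- Coefficient of `P^m ((1+X)/2)^b` at an integer index. -/
noncomputable def Gco (p : ℕ → ℝ) (m b : ℕ) (N : ℤ) : ℝ :=
  if 0 ≤ N then PowerSeries.coeff N.toNat
    ((PowerSeries.mk p) ^ m * (PowerSeries.C (1 / 2 : ℝ) * (1 + PowerSeries.X)) ^ b) else 0

/-- Remainder after removing a Bernoulli component. -/
noncomputable def qrem (p : ℕ → ℝ) (d : ℝ) (k : ℕ) : ℝ := p k - (if k < 2 then d else 0)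

open PowerSeries in
lemma mk_decomp (p : ℕ → ℝ) (d : ℝ) :
    PowerSeries.mk p = C (2 * d) * (C (1 / 2 : ℝ) * (1 + X)) + PowerSeries.mk (qrem p d) := by
  ext n
  rcases n with _ | _ | n
  · rw [map_add, coeff_C_mul, coeff_C_mul]; simp [qrem]; ring
  · rw [map_add, coeff_C_mul, coeff_C_mul]; simp [qrem, coeff_X, coeff_one]; ring
  · rw [map_add, coeff_C_mul, coeff_C_mul]; simp [qrem, coeff_X, coeff_one]

open PowerSeries in
lemma Gco_rec (p : ℕ → ℝ) (d : ℝ) (m b : ℕ) (N : ℤ) :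
    HasSum (fun k : ℕ => qrem p d k * Gco p m b (N - k))
      (Gco p (m + 1) b N - 2 * d * Gco p m (b + 1) N) := by
  by_cases hN : 0 ≤ N
  · obtain ⟨n, rfl⟩ := Int.eq_ofNat_of_zero_le hN
    have : Gco p (m + 1) b (n : ℤ) - 2 * d * Gco p m (b + 1) n
        = ∑ k ∈ Finset.range (n + 1), qrem p d k * Gco p m b ((n : ℤ) - k) := by
      have e : (PowerSeries.mk p) ^ (m + 1) * (C (1 / 2 : ℝ) * (1 + X)) ^ b
          = C (2 * d) * ((PowerSeries.mk p) ^ m * (C (1 / 2 : ℝ) * (1 + X)) ^ (b + 1))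
            + PowerSeries.mk (qrem p d) * ((PowerSeries.mk p) ^ m * (C (1 / 2 : ℝ) * (1 + X)) ^ b) := by
        conv_lhs => rw [pow_succ]
        nth_rewrite 2 [mk_decomp p d]
        ring
      unfold Gco
      rw [if_pos hN, if_pos hN, e, map_add, coeff_C_mul, add_sub_cancel_left, coeff_mul,
        Finset.Nat.sum_antidiagonal_eq_sum_range_succ_mk]
      apply Finset.sum_congr rfl
      intro k hk
      have hk' : k ≤ n := by simpa [Nat.lt_succ_iff] using hk
      have h1 : (0 : ℤ) ≤ (n : ℤ) - k := by omega
      have h2 : ((n : ℤ) - k).toNat = n - k := by omega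
      rw [if_pos h1, h2]
      simp
    rw [this]
    apply hasSum_sum_of_ne_finset_zero
    intro k hk
    have hk' : n < k := by simpa using hk
    have h1 : ¬ (0 : ℤ) ≤ (n : ℤ) - k := by omega
    rw [Gco, if_neg h1, mul_zero]
  · have h1 : ∀ k : ℕ, ¬ (0 : ℤ) ≤ N - k := by intro k; omega
    simp only [Gco, h1, if_neg hN, if_false]
    simp only [mul_zero, sub_zero]
    exact hasSum_zero

lemma qrem_hasSum (p : ℕ → ℝ) (d s : ℝ) (f : ℕ → ℝ) (h : HasSum (fun k => f k * p k) s) :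
    HasSum (fun k => f k * qrem p d k) (s - (f 0 + f 1) * d) := by
  have h2 : HasSum (fun k : ℕ => f k * (if k < 2 then d else 0)) ((f 0 + f 1) * d) := by
    have := hasSum_sum_of_ne_finset_zero (f := fun k : ℕ => f k * (if k < 2 then d else 0))
      (s := Finset.range 2) (by
        intro k hk
        have : ¬ k < 2 := by simpa using hk
        simp [this]) (L := SummationFilter.unconditional ℕ)
    convert this using 1
    simp [Finset.sum_range_succ]; ring
  have h3 := h.sub h2
  have e : (fun k => f k * qrem p d k) = fun k => f k * p k - f k * (if k < 2 then d else 0) := by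
    funext k
    simp only [qrem]; ring
  rw [e]; exact h3

lemma Gco_lower (p : ℕ → ℝ) (d β V W : ℝ) (hd : 0 ≤ d) (hp : ∀ k, 0 ≤ p k) (hp0 : d ≤ p 0)
    (hp1 : d ≤ p 1) (s0 : HasSum p 1) (s1 : HasSum (fun k : ℕ => (k : ℝ) * p k) β)
    (s2 : HasSum (fun k : ℕ => (k : ℝ) ^ 2 * p k) W) (hW : W ≤ V)
    (a A1 A2 L : ℝ) (hA1 : 0 ≤ A1) (hA2 : 0 ≤ A2)
    (base : ∀ (b : ℕ) (N : ℤ),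
      a - A1 * ((b : ℝ) / 2 - N) ^ 2 - A2 * ((b : ℝ) - L) ^ 2 ≤ Gco p 0 b N)
    (m b : ℕ) (N : ℤ) :
    a - A1 * (((b : ℝ) / 2 + m * β - N) ^ 2 + m * V)
      - A2 * (((b : ℝ) + 2 * d * m - L) ^ 2 + m * (2 * d)) ≤ Gco p m b N := by
  induction m generalizing b N with
  | zero => simpa using base b N
  | succ m ih =>
    have hq : ∀ k, 0 ≤ qrem p d k := by
      intro k
      rcases k with _ | _ | k
      · simpa [qrem] using hp0
      · simpa [qrem] using hp1
      · simpa [qrem] using hp _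
    have q0 := qrem_hasSum p d 1 (fun _ => 1) (by simpa using s0)
    have q1 := qrem_hasSum p d β (fun k => (k : ℝ)) s1
    have q2 := qrem_hasSum p d W (fun k => (k : ℝ) ^ 2) s2
    have h1 := ih (b + 1) N
    set y : ℝ := (b : ℝ) / 2 + m * β - N with hy
    set z : ℝ := (b : ℝ) + 2 * d * m - L with hz
    have hs := ((q0.mul_left (a - A1 * (y ^ 2 + m * V) - A2 * (z ^ 2 + m * (2 * d)))).add
      (q1.mul_left (-(2 * A1 * y)))).add (q2.mul_left (-A1))
    have hle := hasSum_le (fun k => ?_) hs (Gco_rec p d m b N)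
    · push_cast at hle h1 ⊢
      have e1 : ((b : ℝ) + 1) / 2 + m * β - N = y + 1 / 2 := by rw [hy]; ring
      have e2 : ((b : ℝ) + 1) + 2 * d * m - L = z + 1 := by rw [hz]; ring
      have e3 : (b : ℝ) / 2 + (m + 1) * β - N = y + β := by rw [hy]; ring
      have e4 : (b : ℝ) + 2 * d * (m + 1) - L = z + 2 * d := by rw [hz]; ring
      rw [e1, e2] at h1
      rw [e3, e4]
      have h1' := mul_le_mul_of_nonneg_left h1 (by linarith : 0 ≤ 2 * d)
      have k1 : 0 ≤ A1 * (β ^ 2 + (V - W) + d / 2) :=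
        mul_nonneg hA1 (by nlinarith [sq_nonneg β])
      have k2 : 0 ≤ A2 * (4 * d ^ 2) := by positivity
      nlinarith
    · have := mul_le_mul_of_nonneg_left (ih b (N - k)) (hq k)
      refine le_trans (le_of_eq ?_) this
      push_cast
      rw [hy, hz]; ring

/-- Uniform lower bound for the masses at `0` and `1`. -/
noncomputable def dlow (t : ℝ) : ℝ := min (t / (1 + t) ^ 2) (Real.exp (-t) / (1 + t) ^ 2)

lemma dlow_pos {t : ℝ} (ht : 0 < t) : 0 < dlow t := by
  unfold dlow; apply lt_min <;> positivity

lemma dlow_le_one {t : ℝ} (ht : 0 < t) : dlow t ≤ 1 := by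
  refine (min_le_left _ _).trans ?_
  rw [div_le_one (by positivity)]; nlinarith

lemma tkf_facts {lam t : ℝ} (h0 : 0 < lam) (h1 : lam < 1) (ht : 0 < t) :
    1 / (1 + t) ≤ 1 - lam * eta lam t ∧ 1 - eta lam t = betaTKF lam t * (1 - lam * eta lam t) ∧
    t / (1 + t) ^ 2 ≤ eta lam t ∧ Real.exp (-t) ≤ betaTKF lam t ∧ betaTKF lam t < 1 ∧
    1 - betaTKF lam t ≤ (1 - lam) * t ∧ 0 < betaTKF lam t := by
  have hx : 0 < (1 - lam) * t := mul_pos (by linarith) ht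
  have hβ0 : 0 < betaTKF lam t := Real.exp_pos _
  have hβ1 : betaTKF lam t < 1 := by
    unfold betaTKF; rw [Real.exp_lt_one_iff]; linarith
  have hβ2 : 1 - betaTKF lam t ≤ (1 - lam) * t := by
    have := Real.add_one_le_exp (-(1 - lam) * t)
    unfold betaTKF; linarith
  have hβ3 : Real.exp (-t) ≤ betaTKF lam t := by
    unfold betaTKF; apply Real.exp_le_exp.2; nlinarith
  have hβ4 : (1 - lam) * t ≤ (1 - betaTKF lam t) * (1 + t) := by
    have h := Real.add_one_le_exp ((1 - lam) * t)
    have e : betaTKF lam t * Real.exp ((1 - lam) * t) = 1 := by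
      unfold betaTKF
      rw [← Real.exp_add, show -(1 - lam) * t + (1 - lam) * t = 0 by ring, Real.exp_zero]
    have h' : betaTKF lam t * ((1 - lam) * t + 1) ≤ 1 := by
      exact (mul_le_mul_of_nonneg_left h hβ0.le).trans e.le
    nlinarith [mul_pos h0 ht]
  have heta : eta lam t = (1 - betaTKF lam t) / (1 - lam * betaTKF lam t) := rfl
  set β := betaTKF lam t
  have hden : 0 < 1 - lam * β := by nlinarith
  have hden2 : 1 - lam * β ≤ (1 - lam) * (1 + t) := by nlinarith
  have hr : 1 - lam * eta lam t = (1 - lam) / (1 - lam * β) := by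
    rw [heta]; field_simp; ring
  refine ⟨?_, ?_, ?_, hβ3, hβ1, hβ2, hβ0⟩
  · rw [hr, div_le_div_iff₀ (by positivity) hden]; linarith
  · have hne := hden.ne'
    rw [hr, heta, eq_comm, mul_div_assoc', div_eq_iff hne, sub_mul, div_mul_cancel₀ _ hne]; ring
  · rw [heta, div_le_div_iff₀ (by positivity) hden]
    calc t * (1 - lam * β) ≤ t * ((1 - lam) * (1 + t)) := by gcongr
      _ = ((1 - lam) * t) * (1 + t) := by ring
      _ ≤ ((1 - β) * (1 + t)) * (1 + t) := by gcongr
      _ = _ := by ring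

lemma hasSum_of_eq {f g : ℕ → ℝ} {a b : ℝ} (h : HasSum g b) (hf : ∀ n, f n = g n) (hab : a = b) :
    HasSum f a := by
  rw [hab, show f = g from funext hf]; exact h

lemma tkf_sums {lam t : ℝ} (h0 : 0 < lam) (h1 : lam < 1) (ht : 0 < t) :
    (∀ k, 0 ≤ pTKF lam t k) ∧ dlow t ≤ pTKF lam t 0 ∧ dlow t ≤ pTKF lam t 1 ∧
    HasSum (pTKF lam t) 1 ∧ HasSum (fun k : ℕ => (k : ℝ) * pTKF lam t k) (betaTKF lam t) ∧
    ∃ W, W ≤ 2 * (1 + t) ∧ HasSum (fun k : ℕ => (k : ℝ) ^ 2 * pTKF lam t k) W := by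
  obtain ⟨f1, f2, f3, f4, f5, f6, f7⟩ := tkf_facts h0 h1 ht
  have he : 0 < eta lam t := lt_of_lt_of_le (by positivity) f3
  set β := betaTKF lam t
  set r := lam * eta lam t with hrdef
  have hr0 : 0 ≤ r := by positivity
  have hr1 : 0 < 1 - r := lt_of_lt_of_le (by positivity) f1
  have hp0 : pTKF lam t 0 = eta lam t := rfl
  have hps : ∀ n, pTKF lam t (n + 1) = β * (1 - r) ^ 2 * r ^ n := by
    intro n
    change (1 - eta lam t) * (1 - r) * r ^ n = _
    rw [f2]; ring
  have hrn : ‖r‖ < 1 := by rw [Real.norm_of_nonneg hr0]; linarith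
  have g0 : HasSum (fun n : ℕ => r ^ n) (1 - r)⁻¹ := hasSum_geometric_of_norm_lt_one hrn
  have g1 := hasSum_choose_mul_geometric_of_norm_lt_one 1 hrn
  have g2 := hasSum_choose_mul_geometric_of_norm_lt_one 2 hrn
  refine ⟨?_, ?_, ?_, ?_, ?_, ⟨β * (1 - r) ^ 2 * (2 * (1 / (1 - r) ^ 3) - 1 / (1 - r) ^ 2), ?_, ?_⟩⟩
  · intro k
    rcases k with _ | k
    · rw [hp0]; exact he.le
    · rw [hps]; positivity
  · exact (min_le_left _ _).trans f3
  · refine (min_le_right _ _).trans ?_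
    rw [show (1 : ℕ) = 0 + 1 from rfl, hps, pow_zero, mul_one]
    calc Real.exp (-t) / (1 + t) ^ 2 = Real.exp (-t) * (1 / (1 + t)) ^ 2 := by
          field_simp
      _ ≤ _ := by gcongr
  · rw [← hasSum_nat_add_iff' 1]
    simp only [hps, Finset.sum_range_one, hp0]
    refine hasSum_of_eq (g0.mul_left (β * (1 - r) ^ 2)) (fun n => rfl) ?_
    rw [f2]; field_simp
  · rw [← hasSum_nat_add_iff' 1]
    simp only [hps, Finset.sum_range_one, hp0]
    refine hasSum_of_eq (g1.mul_left (β * (1 - r) ^ 2)) (fun n => ?_) ?_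
    · simp; ring
    · have := hr1.ne'
      push_cast; field_simp; ring
  · have : β * (1 - r) ^ 2 * (2 * (1 / (1 - r) ^ 3) - 1 / (1 - r) ^ 2) = β * (2 * (1 / (1 - r)) - 1) := by
      field_simp
    rw [this]
    have h2 : 1 / (1 - r) ≤ 1 + t := by
      rw [div_le_iff₀ hr1]
      rw [div_le_iff₀ (by positivity)] at f1; linarith
    have h3 : 1 ≤ 1 / (1 - r) := by rw [le_div_iff₀ hr1]; linarith
    nlinarith
  · rw [← hasSum_nat_add_iff' 1]
    simp only [hps, Finset.sum_range_one, hp0]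
    refine hasSum_of_eq (((g2.mul_left 2).sub g1).mul_left (β * (1 - r) ^ 2)) (fun n => ?_) ?_
    · have : (((n + 2).choose 2 : ℕ) : ℝ) = (n + 2) * (n + 1) / 2 := by
        rw [Nat.cast_choose_two]; push_cast; ring
      rw [this]; simp; ring
    · simp

lemma Gco_zero (p : ℕ → ℝ) (b n : ℕ) : Gco p 0 b (n : ℤ) = Nat.choose b n / 2 ^ b := by
  rw [Gco, if_pos (by positivity), pow_zero, one_mul, mul_pow, ← map_pow, PowerSeries.coeff_C_mul]
  have : (1 + PowerSeries.X : PowerSeries ℝ) ^ b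
      = (((1 + Polynomial.X) ^ b : Polynomial ℝ) : PowerSeries ℝ) := by simp
  rw [this, Polynomial.coeff_coe, Polynomial.coeff_one_add_X_pow]
  simp; field_simp

lemma Gco_neg (p : ℕ → ℝ) (m b : ℕ) (N : ℤ) (hN : N < 0) : Gco p m b N = 0 := by
  rw [Gco, if_neg (by omega)]

set_option maxHeartbeats 1000000 in
lemma local_lower (t D : ℝ) (ht : 0 < t) (hD : 0 ≤ D) : ∃ c : ℝ, 0 < c ∧ ∃ M0 : ℝ, 0 < M0 ∧
    ∀ lam : ℝ, 0 < lam → lam < 1 → ∀ M : ℕ, M0 ≤ M → (M : ℝ) * ((1 - lam) * t) ≤ D →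
    ∀ n : ℕ, M ≤ n → (n : ℝ) ≤ M + Real.sqrt M → c / Real.sqrt M ≤ pS lam t M n := by
  set d := dlow t
  have hd : 0 < d := dlow_pos ht
  have hd1 : d ≤ 1 := dlow_le_one ht
  set V := 2 * (1 + t) with hV
  have hV0 : 0 < V := by positivity
  set A := 1 / (4 * (V + (1 + D) ^ 2)) with hA
  have hA0 : 0 < A := by positivity
  have hAe : A * ((1 + D) ^ 2 + V) = 1 / 4 := by rw [hA]; field_simp; ring
  set K := 4 / (A * d) with hK
  have hK0 : 0 < K := by positivity
  obtain ⟨c0, hc0, b0, hb0, hb⟩ := binom_lower K hK0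
  refine ⟨c0 / (2 * Real.sqrt 3), by positivity, (b0 + K + 8) / d, by positivity, ?_⟩
  intro lam hl0 hl1 M hM hMD n hn1 hn2
  obtain ⟨hp, hp0, hp1, s0, s1, W, hW, s2⟩ := tkf_sums hl0 hl1 ht
  obtain ⟨-, -, -, -, f5, f6, f7⟩ := tkf_facts hl0 hl1 ht
  rw [div_le_iff₀ hd] at hM
  have hM8 : (8 : ℝ) ≤ M := by nlinarith
  have hM0 : (0 : ℝ) < M := by linarith
  set a := c0 / Real.sqrt (3 * M) with ha
  have ha0 : 0 < a := by positivity
  have base : ∀ (b : ℕ) (N : ℤ),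
      a - (a * A / M) * ((b : ℝ) / 2 - N) ^ 2 - (a / (d * M) ^ 2) * ((b : ℝ) - 2 * d * M) ^ 2
        ≤ Gco (pTKF lam t) 0 b N := by
    intro b N
    have hG : 0 ≤ Gco (pTKF lam t) 0 b N := by
      rcases lt_or_ge N 0 with h | h
      · rw [Gco_neg _ _ _ _ h]
      · lift N to ℕ using h
        rw [Gco_zero]; positivity
    have t1 : 0 ≤ (a * A / M) * ((b : ℝ) / 2 - N) ^ 2 := by positivity
    have t2 : 0 ≤ (a / (d * M) ^ 2) * ((b : ℝ) - 2 * d * M) ^ 2 := by positivity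
    by_cases h1 : (d * M) ^ 2 ≤ ((b : ℝ) - 2 * d * M) ^ 2
    · have : a ≤ (a / (d * M) ^ 2) * ((b : ℝ) - 2 * d * M) ^ 2 := by
        rw [div_mul_eq_mul_div, le_div_iff₀ (by positivity)]; gcongr
      linarith
    push Not at h1
    have hab := abs_lt_of_sq_lt_sq h1 (by positivity)
    rw [abs_lt] at hab
    have hbl : d * M ≤ b := by linarith [hab.1]
    have hbu : (b : ℝ) ≤ 3 * M := by nlinarith [hab.2]
    by_cases h2 : (M : ℝ) ≤ A * ((b : ℝ) / 2 - N) ^ 2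
    · have : a ≤ (a * A / M) * ((b : ℝ) / 2 - N) ^ 2 := by
        rw [div_mul_eq_mul_div, le_div_iff₀ (by positivity), mul_assoc]; gcongr
      linarith
    push Not at h2
    have hKb : (2 * (N : ℝ) - b) ^ 2 ≤ K * b := by
      have : (2 * (N : ℝ) - b) ^ 2 * (A * d) ≤ 4 * b := by
        calc (2 * (N : ℝ) - b) ^ 2 * (A * d) = 4 * d * (A * ((b : ℝ) / 2 - N) ^ 2) := by ring
          _ ≤ 4 * d * M := by gcongr
          _ ≤ 4 * b := by linarith
      rw [hK, div_mul_eq_mul_div, le_div_iff₀ (by positivity)]; exact this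
    have hb1 : b0 + K + 8 ≤ b := by linarith
    rcases lt_or_ge N 0 with h | h
    · exfalso
      have hN : (N : ℝ) < 0 := by exact_mod_cast h
      have k1 : (b : ℝ) ^ 2 ≤ (2 * (N : ℝ) - b) ^ 2 := by
        rw [← neg_sq (2 * (N : ℝ) - b)]
        gcongr; linarith
      have k2 : (K + 8) * b ≤ b * b := by gcongr; linarith
      linarith [sq (b : ℝ)]
    · lift N to ℕ using h
      rw [Gco_zero]
      have := hb b (by linarith) N (by exact_mod_cast hKb)
      have h3 : a ≤ c0 / Real.sqrt b := by
        rw [ha]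
        have : 0 < Real.sqrt b := Real.sqrt_pos.2 (by linarith)
        gcongr
      linarith
  have main := Gco_lower (pTKF lam t) d (betaTKF lam t) V W hd.le hp hp0 hp1 s0 s1 s2 hW a
    (a * A / M) (a / (d * M) ^ 2) (2 * d * M) (by positivity) (by positivity) base M 0 (n : ℤ)
  have hGp : Gco (pTKF lam t) M 0 (n : ℤ) = pS lam t M n := by
    rw [pS_eq_coeff, Gco, if_pos (by positivity)]; simp
  rw [hGp] at main
  have hs1 : 1 ≤ Real.sqrt M := Real.one_le_sqrt.2 (by linarith)
  have hss : Real.sqrt M ^ 2 = M := Real.sq_sqrt hM0.le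
  have hsq : ((M : ℝ) * betaTKF lam t - n) ^ 2 ≤ M * (1 + D) ^ 2 := by
    have hn1' : (M : ℝ) ≤ n := by exact_mod_cast hn1
    have e1 : 0 ≤ n - (M : ℝ) * betaTKF lam t := by nlinarith
    have e2 : n - (M : ℝ) * betaTKF lam t ≤ Real.sqrt M * (1 + D) := by
      have : (M : ℝ) * (1 - betaTKF lam t) ≤ D :=
        (mul_le_mul_of_nonneg_left f6 hM0.le).trans hMD
      have hDs : 1 * D ≤ Real.sqrt M * D := mul_le_mul_of_nonneg_right hs1 hD
      linarith
    calc ((M : ℝ) * betaTKF lam t - n) ^ 2 = (n - (M : ℝ) * betaTKF lam t) ^ 2 := by ring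
      _ ≤ (Real.sqrt M * (1 + D)) ^ 2 := by gcongr
      _ = _ := by rw [mul_pow, hss]
  have r1 : (a * A / M) * (((M : ℝ) * betaTKF lam t - n) ^ 2 + M * V) ≤ a / 4 := by
    calc (a * A / M) * (((M : ℝ) * betaTKF lam t - n) ^ 2 + M * V)
        ≤ (a * A / M) * (M * (1 + D) ^ 2 + M * V) := by gcongr
      _ = a * (A * ((1 + D) ^ 2 + V)) := by field_simp
      _ = a / 4 := by rw [hAe]; ring
  have r2 : (a / (d * M) ^ 2) * (M * (2 * d)) ≤ a / 4 := by
    have : (a / (d * M) ^ 2) * (M * (2 * d)) = a * (2 / (M * d)) := by field_simp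
    rw [this]
    have : 2 / (M * d) ≤ 1 / 4 := by
      rw [div_le_div_iff₀ (by positivity) (by norm_num)]; linarith
    nlinarith
  have r3 : c0 / (2 * Real.sqrt 3) / Real.sqrt M = a / 2 := by
    rw [ha, Real.sqrt_mul (by norm_num)]; field_simp
  rw [r3]
  have e : a - (a * A / M) * ((((0 : ℕ) : ℝ) / 2 + M * betaTKF lam t - ((n : ℤ) : ℝ)) ^ 2 + M * V)
      - (a / (d * M) ^ 2) * ((((0 : ℕ) : ℝ) + 2 * d * M - 2 * d * M) ^ 2 + M * (2 * d))
      = a - (a * A / M) * (((M : ℝ) * betaTKF lam t - n) ^ 2 + M * V)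
        - (a / (d * M) ^ 2) * (M * (2 * d)) := by
    push_cast; ring
  rw [e] at main
  linarith

lemma pS_nonneg {lam t : ℝ} (h0 : 0 < lam) (h1 : lam < 1) (ht : 0 < t) (M n : ℕ) :
    0 ≤ pS lam t M n := by
  induction M generalizing n with
  | zero => simp only [pS]; split_ifs <;> norm_num
  | succ M ih => exact Finset.sum_nonneg fun k _ => mul_nonneg (ih k) ((tkf_sums h0 h1 ht).1 _)

lemma pS_summable {lam t : ℝ} (h0 : 0 < lam) (h1 : lam < 1) (ht : 0 < t) (M : ℕ) :
    Summable (fun n => ‖pS lam t M n‖) := by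
  induction M with
  | zero =>
    apply summable_of_ne_finset_zero (s := {0})
    intro n hn
    have : n ≠ 0 := by simpa using hn
    simp [pS, this]
  | succ M ih =>
    exact summable_norm_sum_mul_range_of_summable_norm ih (tkf_sums h0 h1 ht).2.2.2.1.summable.norm

lemma pS_zero_lower {lam t : ℝ} (h0 : 0 < lam) (h1 : lam < 1) (ht : 0 < t) (M : ℕ) :
    dlow t ^ M ≤ pS lam t M 0 := by
  induction M with
  | zero => simp [pS]
  | succ M ih =>
    simp only [pS, zero_add, Finset.sum_range_one, pow_succ]
    exact mul_le_mul ih (tkf_sums h0 h1 ht).2.1 (dlow_pos ht).le (pS_nonneg h0 h1 ht _ _)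

/-- The overlap between the joint laws of the i.i.d. pairs `(S_M(λ,h1), S_M(λ,h1))` and
`(S_M(λ,h2), S_M(λ,h2))` is at least a positive constant, uniformly for `λ ∈ [λ*,1)` and
`M ∈ [c1/(1-λ), c2/(1-λ)]`. -/
theorem joint_overlap_uniform_lower_bound (h1 h2 lamstar c1 c2 : ℝ)
    (hh : h1 > h2) (hh2 : h2 > 0) (hl : lamstar ∈ Set.Ioo (0 : ℝ) 1)
    (hc1 : 0 < c1) (hc1' : c1 < 1) (hc2 : 1 < c2) :
    ∃ c : ℝ, 0 < c ∧
      ∀ lam ∈ Set.Ico lamstar (1 : ℝ), ∀ M : ℕ,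
        c1 / (1 - lam) ≤ (M : ℝ) → (M : ℝ) ≤ c2 / (1 - lam) → 2 ≤ M →
        c ≤ ∑' y : ℕ × ℕ,
          min (pS lam h1 M y.1 * pS lam h1 M y.2)
              (pS lam h2 M y.1 * pS lam h2 M y.2) := by
  have ht1 : 0 < h1 := by linarith
  obtain ⟨ca, hca, Ma, hMa, La⟩ := local_lower h1 (c2 * h1) ht1 (by positivity)
  obtain ⟨cb, hcb, Mb, hMb, Lb⟩ := local_lower h2 (c2 * h2) hh2 (by positivity)
  set cc := min ca cb with hcc
  have hcc0 : 0 < cc := lt_min hca hcb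
  set d := min (dlow h1) (dlow h2) with hd
  have hd0 : 0 < d := lt_min (dlow_pos ht1) (dlow_pos hh2)
  have hd1 : d ≤ 1 := (min_le_left _ _).trans (dlow_le_one ht1)
  set m0 := ⌈max Ma Mb⌉₊ with hm0
  refine ⟨min (cc ^ 2) ((d ^ m0) ^ 2), by positivity, ?_⟩
  intro lam hlam M _ hM2 hM
  have hl0 : 0 < lam := lt_of_lt_of_le hl.1 hlam.1
  have hl1 : lam < 1 := hlam.2
  have n1 := pS_nonneg hl0 hl1 ht1 M
  have n2 := pS_nonneg hl0 hl1 hh2 M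
  have hM0 : (0 : ℝ) < M := by
    have : 0 < M := by omega
    exact_mod_cast this
  set F : ℕ × ℕ → ℝ := fun y => min (pS lam h1 M y.1 * pS lam h1 M y.2)
              (pS lam h2 M y.1 * pS lam h2 M y.2) with hF
  have hF0 : ∀ y, 0 ≤ F y := fun y => le_min (mul_nonneg (n1 _) (n1 _)) (mul_nonneg (n2 _) (n2 _))
  have hsum : Summable F := by
    have s1 : Summable (pS lam h1 M) := (pS_summable hl0 hl1 ht1 M).of_norm
    exact Summable.of_nonneg_of_le hF0 (fun y => min_le_left _ _)
      (s1.mul_of_nonneg s1 (fun n => n1 n) (fun n => n1 n))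
  by_cases hcase : M ≤ m0
  · have hz : (d ^ m0) ^ 2 ≤ F (0, 0) := by
      have e1 : d ^ m0 ≤ d ^ M := pow_le_pow_of_le_one hd0.le hd1 hcase
      have e2 : d ^ M ≤ dlow h1 ^ M := by gcongr; exact min_le_left _ _
      have e3 : d ^ M ≤ dlow h2 ^ M := by gcongr; exact min_le_right _ _
      have f1 := (e1.trans e2).trans (pS_zero_lower hl0 hl1 ht1 M)
      have f2 := (e1.trans e3).trans (pS_zero_lower hl0 hl1 hh2 M)
      rw [sq]
      exact le_min (mul_le_mul f1 f1 (by positivity) (n1 _)) (mul_le_mul f2 f2 (by positivity) (n2 _))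
    exact (min_le_right _ _).trans (hz.trans (hsum.le_tsum (0, 0) fun y _ => hF0 y))
  · push Not at hcase
    have hmax : max Ma Mb ≤ M := (Nat.le_ceil _).trans (by exact_mod_cast hcase.le)
    have hMl : (M : ℝ) * (1 - lam) ≤ c2 := by
      rwa [le_div_iff₀ (by linarith)] at hM2
    have hs0 : 0 < Real.sqrt M := Real.sqrt_pos.2 hM0
    have hss : Real.sqrt M ^ 2 = M := Real.sq_sqrt hM0.le
    set s := Nat.sqrt M with hs
    have hs1 : (s : ℝ) ≤ Real.sqrt M := Real.nat_sqrt_le_real_sqrt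
    have hs2 : Real.sqrt M ≤ s + 1 := Real.real_sqrt_le_nat_sqrt_succ
    set I := Finset.Icc M (M + s) with hI
    have low : ∀ n ∈ I, cc / Real.sqrt M ≤ pS lam h1 M n ∧ cc / Real.sqrt M ≤ pS lam h2 M n := by
      intro n hn
      rw [hI, Finset.mem_Icc] at hn
      have hn2 : (n : ℝ) ≤ M + Real.sqrt M := by
        have : (n : ℝ) ≤ M + s := by exact_mod_cast hn.2
        linarith
      constructor
      · refine le_trans ?_ (La lam hl0 hl1 M ((le_max_left _ _).trans hmax) ?_ n hn.1 hn2)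
        · gcongr; exact min_le_left _ _
        · rw [← mul_assoc]; gcongr
      · refine le_trans ?_ (Lb lam hl0 hl1 M ((le_max_right _ _).trans hmax) ?_ n hn.1 hn2)
        · gcongr; exact min_le_right _ _
        · rw [← mul_assoc]; gcongr
    have hq0 : 0 ≤ cc / Real.sqrt M := by positivity
    have hlow : ∀ y ∈ I ×ˢ I, (cc / Real.sqrt M) ^ 2 ≤ F y := by
      intro y hy
      rw [Finset.mem_product] at hy
      have a1 := low _ hy.1
      have a2 := low _ hy.2
      rw [sq]
      exact le_min (mul_le_mul a1.1 a2.1 hq0 (n1 _)) (mul_le_mul a1.2 a2.2 hq0 (n2 _))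
    have hcard : (I ×ˢ I).card = (s + 1) * (s + 1) := by
      rw [Finset.card_product, hI, Nat.card_Icc]
      congr 1 <;> omega
    have hb := Finset.card_nsmul_le_sum (I ×ˢ I) F _ hlow
    rw [hcard, nsmul_eq_mul] at hb
    push_cast at hb
    refine (min_le_left _ _).trans (le_trans ?_ (hb.trans (hsum.sum_le_tsum _ fun y _ => hF0 y)))
    rw [div_pow, hss, mul_div_assoc', le_div_iff₀ hM0]
    have : (M : ℝ) ≤ ((s : ℝ) + 1) * (s + 1) := by
      rw [← hss, ← sq]; gcongr
    nlinarith [sq_nonneg cc]
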